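/- Let p, N be natural numbers with N ≥ p + 2. There exists a constant C > 0, depending only on p and N, such that for every A ≥ 0 and every continuous function F : ℝ → ℝ with F(u) ≥ 0 for all u and |∫₀^λ F(u) du| ≤ A(1+λ²)^p for all λ ∈ ℝ, the function u ↦ F(u)(1+u²)^{−N} is integrable on ℝ and ∫_ℝ F(u)(1+u²)^{−N} du ≤ C·A. -/

import Mathlib

open MeasureTheory intervalIntegral

/-- The derivative of the weight `u ↦ (1 + u²)^{−N}`. -/
lemma hasDerivAt_inv_one_add_sq_pow (N : ℕ) (x : ℝ) :
    HasDerivAt (fun u : ℝ => ((1 + u ^ 2) ^ N)⁻¹)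
      (-(2 * N * x) / (1 + x ^ 2) ^ (N + 1)) x := by
  have hx : (1 + x ^ 2 : ℝ) ≠ 0 := by positivity
  have h := (((hasDerivAt_pow 2 x).const_add 1).fun_pow N).fun_inv (pow_ne_zero N hx)
  refine h.congr_deriv ?_
  rcases N with _ | N
  · simp
  · push_cast
    field_simp
    ring

/-- Integration by parts on `[-r, r]` against the weight `(1 + u²)^{−N}`, for a function whose
antiderivative is bounded by `A (1 + u²)^p`. -/
lemma intervalIntegral_div_one_add_sq_pow_le {p N : ℕ} (hN : p + 1 ≤ N) {A : ℝ} (hA : 0 ≤ A)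
    {F : ℝ → ℝ} (hF : Continuous F)
    (hbound : ∀ l : ℝ, |∫ u in (0:ℝ)..l, F u| ≤ A * (1 + l ^ 2) ^ p) {r : ℝ} (hr : 0 ≤ r) :
    (∫ u in (-r)..r, F u / (1 + u ^ 2) ^ N) ≤ (2 + N * Real.pi) * A := by
  set G : ℝ → ℝ := fun l => ∫ u in (0:ℝ)..l, F u
  have hG' : ∀ x, HasDerivAt G (F x) x := fun x => hF.integral_hasStrictDerivAt 0 x |>.hasDerivAt
  have hGc : Continuous G := continuous_iff_continuousAt.2 fun x => (hG' x).continuousAt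
  have hwc : Continuous fun u : ℝ => -(2 * N * u) / (1 + u ^ 2) ^ (N + 1) :=
    Continuous.div (by fun_prop) (by fun_prop) fun x => by positivity
  have hGw : ∀ x : ℝ, |G x| / (1 + x ^ 2) ^ N ≤ A * (1 + x ^ 2)⁻¹ := fun x => by
    have h1 : (1 : ℝ) ≤ 1 + x ^ 2 := by nlinarith [sq_nonneg x]
    have h0 : (0 : ℝ) < 1 + x ^ 2 := by positivity
    rw [← div_eq_mul_inv, div_le_div_iff₀ (by positivity) h0]
    calc |G x| * (1 + x ^ 2) ≤ A * (1 + x ^ 2) ^ p * (1 + x ^ 2) := by gcongr; exact hbound x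
      _ = A * (1 + x ^ 2) ^ (p + 1) := by ring
      _ ≤ A * (1 + x ^ 2) ^ N := by gcongr
  have hend : ∀ x : ℝ, |((1 + x ^ 2) ^ N)⁻¹ * G x| ≤ A := fun x => by
    have hx : 0 < (1 + x ^ 2) ^ N := by positivity
    rw [abs_mul, abs_of_pos (inv_pos.2 hx), mul_comm, ← div_eq_mul_inv]
    refine (hGw x).trans (mul_le_of_le_one_right hA (inv_le_one_of_one_le₀ ?_))
    nlinarith [sq_nonneg x]
  have hrem : ∀ x : ℝ, -(N * A * (1 + x ^ 2)⁻¹) ≤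
      -(2 * N * x) / (1 + x ^ 2) ^ (N + 1) * G x := fun x => by
    have h0 : (0 : ℝ) < 1 + x ^ 2 := by positivity
    have hx : |2 * x| / (1 + x ^ 2) ≤ 1 := by
      rw [div_le_one h0, abs_le]
      constructor <;> nlinarith [sq_nonneg (x - 1), sq_nonneg (x + 1)]
    have habs : |-(2 * N * x) / (1 + x ^ 2) ^ (N + 1) * G x| =
        N * ((|2 * x| / (1 + x ^ 2)) * (|G x| / (1 + x ^ 2) ^ N)) := by
      rw [abs_mul, abs_div, abs_neg, abs_of_pos (pow_pos h0 (N + 1)),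
        show 2 * (N : ℝ) * x = N * (2 * x) by ring, abs_mul (N : ℝ), Nat.abs_cast, pow_succ]
      field_simp
    refine (abs_le.1 ?_).1
    rw [habs, mul_assoc]
    refine mul_le_mul_of_nonneg_left ?_ N.cast_nonneg
    exact (mul_le_of_le_one_left (by positivity) hx).trans (hGw x)
  have hparts := integral_mul_deriv_eq_deriv_mul (a := -r) (b := r)
    (fun x _ => hasDerivAt_inv_one_add_sq_pow N x) (fun x _ => hG' x)
    (hwc.intervalIntegrable _ _) (hF.intervalIntegrable _ _)
  have hrem_int : -(N * A * Real.pi) ≤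
      ∫ x in (-r)..r, -(2 * N * x) / (1 + x ^ 2) ^ (N + 1) * G x := by
    have hi : IntervalIntegrable (fun x : ℝ => -(N * A * (1 + x ^ 2)⁻¹)) volume (-r) r :=
      (integrable_inv_one_add_sq.const_mul (N * A : ℝ)).neg.intervalIntegrable
    refine le_trans ?_ (integral_mono_on (by linarith) hi
      ((hwc.mul hGc).intervalIntegrable _ _) fun x _ => hrem x)
    rw [intervalIntegral.integral_neg, intervalIntegral.integral_const_mul,
      integral_inv_one_add_sq, neg_le_neg_iff]
    gcongr
    linarith [Real.arctan_lt_pi_div_two r, Real.neg_pi_div_two_lt_arctan (-r)]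
  simp only [div_eq_inv_mul (F _)]
  rw [hparts]
  linarith [(abs_le.1 (hend r)).2, (abs_le.1 (hend (-r))).1]

/-- Let `N ≥ p + 2`.  There is a constant `C > 0`, depending only on `p` and `N`, such
that for every `A ≥ 0` and every continuous nonnegative `F : ℝ → ℝ` with
`|∫₀^λ F| ≤ A(1+λ²)^p` for all `λ`, the function `u ↦ F(u)(1+u²)^{−N}` is integrable
on `ℝ` and `∫_ℝ F(u)(1+u²)^{−N} du ≤ C·A`. -/
theorem integrable_of_antideriv_poly_bound (p N : ℕ) (hN : p + 2 ≤ N) :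
    ∃ C : ℝ, 0 < C ∧ ∀ A : ℝ, 0 ≤ A → ∀ F : ℝ → ℝ, Continuous F →
      (∀ u : ℝ, 0 ≤ F u) →
      (∀ l : ℝ, |∫ u in (0:ℝ)..l, F u| ≤ A * (1 + l ^ 2) ^ p) →
      Integrable (fun u : ℝ => F u / (1 + u ^ 2) ^ N) ∧
      (∫ u : ℝ, F u / (1 + u ^ 2) ^ N) ≤ C * A := by
  refine ⟨2 + N * Real.pi, by positivity, fun A hA F hF hF0 hbound => ?_⟩
  have hc : Continuous fun u : ℝ => F u / (1 + u ^ 2) ^ N :=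
    hF.div (by fun_prop) fun x => by positivity
  have hle : ∀ᶠ r : ℝ in Filter.atTop,
      (∫ u in (-r)..r, F u / (1 + u ^ 2) ^ N) ≤ (2 + N * Real.pi) * A := by
    filter_upwards [Filter.eventually_ge_atTop 0] with r hr
    exact intervalIntegral_div_one_add_sq_pow_le (by omega) hA hF hbound hr
  have hint : Integrable fun u : ℝ => F u / (1 + u ^ 2) ^ N := by
    refine integrable_of_intervalIntegral_norm_bounded ((2 + N * Real.pi) * A)
      (fun r => (hc.integrableOn_Icc).mono_set Set.Ioc_subset_Icc_self)
      Filter.tendsto_neg_atTop_atBot Filter.tendsto_id (hle.mono fun r hr => ?_)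
    have hnorm (u : ℝ) : ‖F u / (1 + u ^ 2) ^ N‖ = F u / (1 + u ^ 2) ^ N :=
      Real.norm_of_nonneg (div_nonneg (hF0 u) (by positivity))
    simpa only [id, hnorm] using hr
  exact ⟨hint, le_of_tendsto (intervalIntegral_tendsto_integral hint
    Filter.tendsto_neg_atTop_atBot Filter.tendsto_id) hle⟩
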